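/- Let n ≥ 0 and suppose s_1^n = g_1⋯g_r in G = ℤ/2 * ℤ/3, where each g_i is a conjugate of s_1 = bwb. Then r ≥ n, and a finite sequence of Hurwitz moves transforms the sequence (g_1,…,g_r) into a sequence (g_1',…,g_r') of conjugates of s_1 with g_1' = g_2' = ⋯ = g_n' = s_1 and g_{n+1}'⋯g_r' = 1. -/

import Mathlib

/-- `G = ℤ/2 * ℤ/3`, the free product of cyclic groups of orders 2 and 3
(isomorphic to `PSL(2,ℤ)`). -/
abbrev G23 := Monoid.Coprod (Multiplicative (ZMod 2)) (Multiplicative (ZMod 3))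

/-- The generator `w` of the `ℤ/2` factor. -/
def w : G23 := Monoid.Coprod.inl (Multiplicative.ofAdd (1 : ZMod 2))

/-- The generator `b` of the `ℤ/3` factor. -/
def b : G23 := Monoid.Coprod.inr (Multiplicative.ofAdd (1 : ZMod 3))

/-- `s₀ = wb²`. -/
def s0 : G23 := w * b ^ 2

/-- `s₁ = bwb`. -/
def s1 : G23 := b * w * b

/-- `s₂ = b²w`. -/
def s2 : G23 := b ^ 2 * w

/-- A single Hurwitz move on a finite sequence of elements of a group: some consecutive
pair `(a, b)` is replaced by `(b, b⁻¹ * a * b)` or by `(a * b * a⁻¹, a)`. -/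
def HurwitzMove {G : Type*} [Group G] (L L' : List G) : Prop :=
  ∃ (p : List G) (x y : G) (t : List G),
    L = p ++ x :: y :: t ∧
    (L' = p ++ y :: (y⁻¹ * x * y) :: t ∨ L' = p ++ (x * y * x⁻¹) :: x :: t)

/-- A finite sequence of Hurwitz moves. -/
def HurwitzEquiv {G : Type*} [Group G] : List G → List G → Prop :=
  Relation.ReflTransGen HurwitzMove

/-! ### Hurwitz moves -/

section Hurwitz

variable {G : Type*} [Group G]

theorem HurwitzMove.cons {L L' : List G} (h : HurwitzMove L L') (a : G) :
    HurwitzMove (a :: L) (a :: L') := by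
  obtain ⟨p, x, y, t, rfl, rfl | rfl⟩ := h
  · exact ⟨a :: p, x, y, t, rfl, Or.inl rfl⟩
  · exact ⟨a :: p, x, y, t, rfl, Or.inr rfl⟩

theorem HurwitzMove.prod_eq {L L' : List G} (h : HurwitzMove L L') : L'.prod = L.prod := by
  obtain ⟨p, x, y, t, rfl, rfl | rfl⟩ := h <;> simp [mul_assoc]

theorem HurwitzMove.length_eq {L L' : List G} (h : HurwitzMove L L') :
    L'.length = L.length := by
  obtain ⟨p, x, y, t, rfl, rfl | rfl⟩ := h <;> simp

theorem HurwitzMove.forall_isConj {s : G} {L L' : List G} (h : HurwitzMove L L')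
    (hL : ∀ g ∈ L, IsConj s g) : ∀ g ∈ L', IsConj s g := by
  obtain ⟨p, x, y, t, rfl, rfl | rfl⟩ := h
  · intro g hg
    have hx : IsConj s (y⁻¹ * x * y) :=
      (hL x (by simp)).trans (isConj_iff.2 ⟨y⁻¹, by simp⟩)
    simp only [List.mem_append, List.mem_cons] at hg hL
    rcases hg with hg | rfl | rfl | hg <;> first | exact hx | exact hL _ (by tauto)
  · intro g hg
    have hy : IsConj s (x * y * x⁻¹) :=
      (hL y (by simp)).trans (isConj_iff.2 ⟨x, rfl⟩)
    simp only [List.mem_append, List.mem_cons] at hg hL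
    rcases hg with hg | rfl | rfl | hg <;> first | exact hy | exact hL _ (by tauto)

theorem HurwitzEquiv.cons {L L' : List G} (h : HurwitzEquiv L L') (a : G) :
    HurwitzEquiv (a :: L) (a :: L') :=
  Relation.ReflTransGen.lift (a :: ·) (fun _ _ h => HurwitzMove.cons h a) _ _ h

theorem HurwitzEquiv.prod_eq {L L' : List G} (h : HurwitzEquiv L L') : L'.prod = L.prod := by
  induction h with
  | refl => rfl
  | tail _ h ih => rw [h.prod_eq, ih]

theorem HurwitzEquiv.length_eq {L L' : List G} (h : HurwitzEquiv L L') :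
    L'.length = L.length := by
  induction h with
  | refl => rfl
  | tail _ h ih => rw [h.length_eq, ih]

theorem HurwitzEquiv.forall_isConj {s : G} {L L' : List G} (h : HurwitzEquiv L L')
    (hL : ∀ g ∈ L, IsConj s g) : ∀ g ∈ L', IsConj s g := by
  induction h with
  | refl => exact hL
  | tail _ h ih => exact h.forall_isConj ih

/-- Any term of a sequence can be moved unchanged to the front. -/
theorem HurwitzEquiv.exists_cons_of_mem {s : G} :
    ∀ {L : List G}, s ∈ L → ∃ T, HurwitzEquiv L (s :: T)
  | a :: L, hs => by
    rcases List.mem_cons.1 hs with rfl | hs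
    · exact ⟨L, Relation.ReflTransGen.refl⟩
    · obtain ⟨T, hT⟩ := HurwitzEquiv.exists_cons_of_mem hs
      exact ⟨_, (hT.cons a).tail ⟨[], a, s, T, rfl, Or.inl rfl⟩⟩

end Hurwitz

/-! ### Reduced words in `ℤ/2 * ℤ/3` -/

namespace G23

theorem w_mul_w : w * w = 1 := by
  rw [w, ← map_mul, ← ofAdd_add]
  exact map_one _

theorem b_mul_b_mul_b : b * (b * b) = 1 := by
  rw [b, ← map_mul, ← map_mul, ← ofAdd_add, ← ofAdd_add]
  exact map_one _

theorem w_mul_w_mul (z : G23) : w * (w * z) = z := by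
  rw [← mul_assoc, w_mul_w, one_mul]

theorem b_mul_b_mul_b_mul (z : G23) : b * (b * (b * z)) = z := by
  simpa [mul_assoc] using congrArg (· * z) b_mul_b_mul_b

theorem w_inv : w⁻¹ = w := inv_eq_of_mul_eq_one_right w_mul_w

theorem b_inv : b⁻¹ = b * b := inv_eq_of_mul_eq_one_right b_mul_b_mul_b

theorem b_pow_three : b ^ 3 = 1 := by
  rw [pow_succ, pow_two, mul_assoc, b_mul_b_mul_b]

/-- The letter `wb²` (for `true`) or `wb` (for `false`). -/
def letter (c : Bool) : G23 := w * (if c then b * b else b)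

/-- The element of `G` spelled by a list of letters. -/
def eval (k : List Bool) : G23 := (k.map letter).prod

@[simp] theorem eval_nil : eval [] = 1 := rfl

@[simp] theorem eval_cons (c : Bool) (k : List Bool) : eval (c :: k) = letter c * eval k := by
  simp [eval]

theorem eval_append (k l : List Bool) : eval (k ++ l) = eval k * eval l := by
  simp [eval]

/-- The conjugate of `s₀ = wb²` by `bⁱ` times the word `k`. -/
def conjElt (i : ℕ) (k : List Bool) : G23 :=
  b ^ i * eval k * letter true * (eval k)⁻¹ * (b ^ i)⁻¹

/-- Words not ending in the letter `wb²`, which commutes with `s₀`. -/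
def Canonical (k : List Bool) : Prop := k.getLast? ≠ some true

theorem canonical_nil : Canonical [] := by simp [Canonical]

theorem Canonical.tail {c : Bool} {k : List Bool} (h : Canonical (c :: k)) : Canonical k := by
  cases k with
  | nil => exact canonical_nil
  | cons a k => simpa [Canonical] using h

theorem not_canonical_true : ¬ Canonical [true] := by simp [Canonical]

theorem exists_canonical (k : List Bool) :
    ∃ k', Canonical k' ∧ k'.length ≤ k.length ∧ ∀ i, conjElt i k' = conjElt i k := by
  induction k using List.reverseRecOn with
  | nil => exact ⟨[], canonical_nil, le_rfl, fun _ => rfl⟩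
  | append_singleton k c ih =>
    cases c with
    | false => exact ⟨k ++ [false], by simp [Canonical], le_rfl, fun _ => rfl⟩
    | true =>
      obtain ⟨k', h1, h2, h3⟩ := ih
      refine ⟨k', h1, by simp; omega, fun i => ?_⟩
      rw [h3 i]
      simp [conjElt, eval_append, mul_assoc]

theorem b_pow_mod (i : ℕ) : b ^ (i % 3) = b ^ i := (pow_eq_pow_mod i b_pow_three).symm

/-- `x` is the conjugate of `s₀` attached to a canonical word of length less than `n`. -/
def HasShortForm (n : ℕ) (x : G23) : Prop :=
  ∃ i k, Canonical k ∧ k.length < n ∧ conjElt i k = x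

theorem hasShortForm_conjElt {n : ℕ} (i : ℕ) {k : List Bool} (h : k.length < n) :
    HasShortForm n (conjElt i k) := by
  obtain ⟨k', h1, h2, h3⟩ := exists_canonical k
  exact ⟨i, k', h1, by omega, h3 i⟩

theorem HasShortForm.conj_b_pow {n : ℕ} {x : G23} (h : HasShortForm n x) (i : ℕ) :
    HasShortForm n (b ^ i * x * (b ^ i)⁻¹) := by
  obtain ⟨j, k, hk, hn, rfl⟩ := h
  exact ⟨i + j, k, hk, hn, by simp [conjElt, pow_add, mul_assoc]⟩

theorem HasShortForm.conj_w {n : ℕ} {x : G23} (h : HasShortForm n x) :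
    HasShortForm (n + 1) (w * x * w⁻¹) := by
  obtain ⟨j, k, hk, hn, rfl⟩ := h
  have hj : j % 3 < 3 := Nat.mod_lt _ (by norm_num)
  have key : conjElt j k = conjElt (j % 3) k := by simp [conjElt, b_pow_mod]
  rw [key]
  generalize j % 3 = d at hj
  interval_cases d
  · cases k with
    | nil =>
      convert hasShortForm_conjElt (n := n + 1) 2 (k := []) (by simp) using 1
      simp [conjElt, letter, pow_two, mul_assoc, w_mul_w_mul, w_inv, b_inv,
        b_mul_b_mul_b]
    | cons c k =>
      have hn' : k.length < n + 1 := by simp at hn; omega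
      convert hasShortForm_conjElt (if c then 2 else 1) hn' using 1
      cases c <;>
      simp [conjElt, letter, pow_two, mul_assoc, w_mul_w, w_mul_w_mul, w_inv, b_inv]
  · convert hasShortForm_conjElt (n := n + 1) 0 (k := false :: k) (by simpa using hn) using 1
    simp [conjElt, letter, mul_assoc]
  · convert hasShortForm_conjElt (n := n + 1) 0 (k := true :: k) (by simpa using hn) using 1
    simp [conjElt, letter, pow_two, mul_assoc]

theorem HasShortForm.conj_letter {n : ℕ} {x : G23} (h : HasShortForm n x) (c : Bool) :
    HasShortForm (n + 1) (letter c * x * (letter c)⁻¹) := by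
  convert (h.conj_b_pow (if c then 2 else 1)).conj_w using 1
  cases c <;> simp [letter, pow_two, mul_assoc]

theorem exists_conjElt_conj (g x : G23) (hx : ∃ i k, conjElt i k = x) :
    ∃ i k, conjElt i k = g * x * g⁻¹ := by
  have of_short {n y} : HasShortForm n y → ∃ i k, conjElt i k = y :=
    fun ⟨i, k, _, _, h⟩ => ⟨i, k, h⟩
  have hw (y : G23) : (∃ i k, conjElt i k = y) → ∃ i k, conjElt i k = w * y * w⁻¹ := by
    rintro ⟨i, k, rfl⟩
    exact of_short (hasShortForm_conjElt i (Nat.lt_succ_self k.length)).conj_w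
  have hb (n : ℕ) (y : G23) :
      (∃ i k, conjElt i k = y) → ∃ i k, conjElt i k = b ^ n * y * (b ^ n)⁻¹ := by
    rintro ⟨i, k, rfl⟩
    exact of_short ((hasShortForm_conjElt i (Nat.lt_succ_self k.length)).conj_b_pow n)
  induction g using Monoid.Coprod.induction_on generalizing x with
  | inl m =>
    have : Monoid.Coprod.inl m = (1 : G23) ∨ Monoid.Coprod.inl m = w := by
      have hm : m = 1 ∨ m = Multiplicative.ofAdd (1 : ZMod 2) := by
        revert m; decide
      rcases hm with rfl | rfl
      · exact Or.inl (map_one _)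
      · exact Or.inr rfl
    rcases this with h | h <;> rw [h]
    · simpa using hx
    · exact hw x hx
  | inr m =>
    have : ∃ n : ℕ, Monoid.Coprod.inr m = b ^ n := by
      have hm : ∃ n : ℕ, m = Multiplicative.ofAdd (1 : ZMod 3) ^ n := by
        have : m = 1 ∨ m = Multiplicative.ofAdd (1 : ZMod 3) ∨
          m = Multiplicative.ofAdd (1 : ZMod 3) ^ 2 := by revert m; decide
        rcases this with rfl | rfl | rfl
        exacts [⟨0, rfl⟩, ⟨1, (pow_one _).symm⟩, ⟨2, rfl⟩]
      obtain ⟨n, rfl⟩ := hm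
      exact ⟨n, map_pow _ _ _⟩
    obtain ⟨n, h⟩ := this
    rw [h]
    exact hb n x hx
  | mul g h ihg ihh =>
    convert ihg _ (ihh x hx) using 4
    simp [mul_assoc]

theorem s1_eq_conjElt : conjElt 1 [] = s1 := by
  simp [conjElt, s1, letter, mul_assoc, b_inv, b_mul_b_mul_b_mul]

theorem exists_canonical_of_isConj {g : G23} (h : IsConj s1 g) :
    ∃ i k, Canonical k ∧ conjElt i k = g := by
  obtain ⟨c, rfl⟩ := isConj_iff.1 h
  obtain ⟨i, k, hk⟩ := exists_conjElt_conj c s1 ⟨1, [], s1_eq_conjElt⟩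
  obtain ⟨k', h1, -, h3⟩ := exists_canonical k
  exact ⟨i, k', h1, (h3 i).trans hk⟩

/-! ### Products of words without deep cancellation -/

/-- Elements whose reduced word starts with `w`. -/
inductive StartsW : G23 → Prop
  | w : StartsW w
  | letter (c : Bool) : StartsW (letter c)
  | letter_mul (c : Bool) {e : G23} : StartsW e → StartsW (letter c * e)

theorem StartsW.eval_mul (k : List Bool) {e : G23} (h : StartsW e) : StartsW (eval k * e) := by
  induction k with
  | nil => simpa using h
  | cons c k ih => simpa [mul_assoc] using ih.letter_mul c

theorem StartsW.letter_mul' (c : Bool) {e : G23} (h : e = 1 ∨ StartsW e) :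
    StartsW (G23.letter c * e) := by
  rcases h with rfl | h
  · simpa using StartsW.letter c
  · exact h.letter_mul c

theorem startsW_of_canonical {k : List Bool} (hk : Canonical k) (hne : k ≠ []) (c : Bool)
    {e : G23} (he : e = 1 ∨ StartsW e) :
    StartsW (letter true * (eval k)⁻¹ * (w * letter c) * e) := by
  induction k generalizing c e with
  | nil => exact absurd rfl hne
  | cons a k ih =>
    by_cases hk' : k = []
    · subst hk'
      cases a with
      | true => exact absurd hk not_canonical_true
      | false =>
        convert (StartsW.letter_mul' c he).letter_mul false using 1
        simp [letter, mul_assoc, w_mul_w_mul, w_inv, b_inv, b_mul_b_mul_b_mul]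
    · convert ih hk.tail hk' (!a) (Or.inr (StartsW.letter_mul' c he)) using 1
      cases a <;> simp [letter, mul_assoc, w_mul_w_mul, w_inv, b_inv, b_mul_b_mul_b_mul]

theorem startsW_conjElt {k : List Bool} (hk : Canonical k) (i : ℕ) :
    StartsW (letter true * (eval k)⁻¹ * (b ^ i)⁻¹) := by
  have hj : i % 3 < 3 := Nat.mod_lt _ (by norm_num)
  rw [← b_pow_mod i]
  generalize i % 3 = d at hj
  by_cases hk' : k = []
  · subst hk'
    interval_cases d
    · simpa using StartsW.letter true
    · convert StartsW.letter false using 1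
      simp [letter, mul_assoc, b_inv, b_mul_b_mul_b_mul]
    · convert StartsW.w using 1
      simp [letter, pow_two, mul_assoc, b_inv, b_mul_b_mul_b]
  interval_cases d
  · cases k with
    | nil => exact absurd rfl hk'
    | cons a k =>
      by_cases hk'' : k = []
      · subst hk''
        cases a with
        | true => exact absurd hk not_canonical_true
        | false =>
          convert StartsW.w.letter_mul false using 1
          simp [letter, mul_assoc, w_inv, b_inv, b_mul_b_mul_b_mul]
      · convert startsW_of_canonical hk.tail hk'' (!a) (Or.inr StartsW.w) using 1
        cases a <;> simp [letter, mul_assoc, w_mul_w_mul, w_inv, b_inv, b_mul_b_mul_b_mul]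
  · convert startsW_of_canonical hk hk' true (Or.inl rfl) using 1
    simp [letter, mul_assoc, w_mul_w_mul, b_inv]
  · convert startsW_of_canonical hk hk' false (Or.inl rfl) using 1
    simp [letter, pow_two, mul_assoc, w_mul_w_mul, b_inv, b_mul_b_mul_b_mul]

/-- Multiplying by the conjugate `x` attached to `k` preserves the deep part of the word `bᵈ l`,
or a Hurwitz move on the pair attached to `k` and `bᵈ l` shortens one of the two words, or the
pair is `(s₀, s₁)`. -/
def PairAlternative (k l : List Bool) (d : ℕ) : Prop :=
  (∀ e, StartsW e → StartsW (letter true * (eval k)⁻¹ * b ^ d * eval l * e)) ∨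
  HasShortForm l.length (conjElt 0 k * conjElt d l * (conjElt 0 k)⁻¹) ∨
  HasShortForm k.length ((conjElt d l)⁻¹ * conjElt 0 k * conjElt d l) ∨
  (d = 1 ∧ k = [] ∧ l = [])

theorem pairAlternative_of_ne_nil {k : List Bool} (hk : Canonical k) (hne : k ≠ [])
    (l : List Bool) {d : ℕ} (hd : d = 1 ∨ d = 2) : PairAlternative k l d := by
  refine Or.inl fun e he => ?_
  rcases hd with rfl | rfl
  · convert startsW_of_canonical hk hne false (Or.inr (he.eval_mul l)) using 1
    simp [letter, mul_assoc, w_mul_w_mul]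
  · convert startsW_of_canonical hk hne true (Or.inr (he.eval_mul l)) using 1
    simp [letter, pow_two, mul_assoc, w_mul_w_mul]

theorem pairAlternative_nil (l : List Bool) {d : ℕ} (hd : d = 1 ∨ d = 2) :
    PairAlternative [] l d := by
  rcases hd with rfl | rfl
  · cases l with
    | nil => exact Or.inr (Or.inr (Or.inr ⟨rfl, rfl, rfl⟩))
    | cons c l =>
      refine Or.inr (Or.inl ?_)
      convert hasShortForm_conjElt (n := (c :: l).length) (if c then 2 else 1) (k := l)
        (by simp) using 1
      cases c <;> simp [conjElt, letter, pow_two, mul_assoc, w_mul_w, w_mul_w_mul, w_inv, b_inv,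
        b_mul_b_mul_b_mul]
  · refine Or.inl fun e he => ?_
    convert (he.eval_mul l).letter_mul false using 1
    simp [letter, pow_two, mul_assoc, b_mul_b_mul_b_mul]

theorem pairAlternative_of_ne_zero {k : List Bool} (hk : Canonical k) (l : List Bool) {d : ℕ}
    (hd : d = 1 ∨ d = 2) : PairAlternative k l d := by
  by_cases hne : k = []
  · exact hne ▸ pairAlternative_nil l hd
  · exact pairAlternative_of_ne_nil hk hne l hd

theorem PairAlternative.cons {k l : List Bool} {d : ℕ} (h : PairAlternative k l d) (c a : Bool)
    (hca : letter a = letter c * b ^ d) (hspecial : ¬ (d = 1 ∧ k = [] ∧ l = [])) :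
    PairAlternative (c :: k) (a :: l) 0 := by
  have hx : conjElt 0 (c :: k) = letter c * conjElt 0 k * (letter c)⁻¹ := by
    simp [conjElt, mul_assoc]
  have hy : conjElt 0 (a :: l) = letter c * conjElt d l * (letter c)⁻¹ := by
    simp [conjElt, hca, mul_assoc]
  rcases h with h | h | h | h
  · refine Or.inl fun e he => ?_
    convert h e he using 1
    simp [hca, mul_assoc]
  · refine Or.inr (Or.inl ?_)
    rw [hx, hy]
    convert h.conj_letter c using 1
    · simp
    · group
  · refine Or.inr (Or.inr (Or.inl ?_))
    rw [hx, hy]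
    convert h.conj_letter c using 1
    · simp
    · group
  · exact absurd h hspecial

theorem pairAlternative_zero {k l : List Bool} (hk : Canonical k) (hl : Canonical l) :
    PairAlternative k l 0 := by
  induction k generalizing l with
  | nil =>
    refine Or.inl fun e he => ?_
    simpa [mul_assoc] using (he.eval_mul l).letter_mul true
  | cons c k ih =>
    cases l with
    | nil =>
      refine Or.inr (Or.inr (Or.inl ?_))
      convert hasShortForm_conjElt (n := (c :: k).length) (if c then 0 else 2) (k := k)
        (by simp) using 1
      cases c <;> simp [conjElt, letter, pow_two, mul_assoc, w_mul_w_mul, w_inv, b_inv,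
        b_mul_b_mul_b, b_mul_b_mul_b_mul]
    | cons a l =>
      have ht := hk.tail
      cases c <;> cases a
      · exact (ih ht hl.tail).cons _ _ (by simp) (by simp)
      · refine (pairAlternative_of_ne_zero ht l (Or.inl rfl)).cons _ _
          (by simp [letter, mul_assoc]) ?_
        rintro ⟨-, -, rfl⟩
        exact not_canonical_true hl
      · refine (pairAlternative_of_ne_zero ht l (Or.inr rfl)).cons _ _ ?_ (by simp)
        simp [letter, pow_two, mul_assoc, b_mul_b_mul_b]
      · exact (ih ht hl.tail).cons _ _ (by simp) (by simp)

theorem pairAlternative {k l : List Bool} (hk : Canonical k) (hl : Canonical l) {d : ℕ}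
    (hd : d < 3) : PairAlternative k l d := by
  rcases Nat.eq_zero_or_pos d with rfl | h
  · exact pairAlternative_zero hk hl
  · exact pairAlternative_of_ne_zero hk l (by omega)

theorem exists_b_pow_add (i j : ℕ) : ∃ d < 3, b ^ j = b ^ i * b ^ d := by
  refine ⟨(j + 2 * i) % 3, Nat.mod_lt _ (by norm_num), ?_⟩
  rw [b_pow_mod, ← pow_add, show i + (j + 2 * i) = j + 3 * i by ring, pow_add, pow_mul,
    b_pow_three, one_pow, mul_one]

/-- A pair on which a Hurwitz move shortens one of the words or produces `s₁`. -/
def Reducible (x y : ℕ × List Bool) : Prop :=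
  HasShortForm y.2.length (conjElt x.1 x.2 * conjElt y.1 y.2 * (conjElt x.1 x.2)⁻¹) ∨
  HasShortForm x.2.length ((conjElt y.1 y.2)⁻¹ * conjElt x.1 x.2 * conjElt y.1 y.2) ∨
  conjElt x.1 x.2 = s1 ∨ conjElt y.1 y.2 = s1 ∨
  (conjElt y.1 y.2)⁻¹ * conjElt x.1 x.2 * conjElt y.1 y.2 = s1

theorem startsW_or_reducible {i j : ℕ} {k l : List Bool} (hk : Canonical k) (hl : Canonical l) :
    (∀ e, StartsW e → ∃ e', StartsW e' ∧
      conjElt i k * (b ^ j * eval l * e) = b ^ i * eval k * e') ∨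
    Reducible (i, k) (j, l) := by
  obtain ⟨d, hd, hj⟩ := exists_b_pow_add i j
  have hx : conjElt i k = b ^ i * conjElt 0 k * (b ^ i)⁻¹ := by simp [conjElt, mul_assoc]
  have hy : conjElt j l = b ^ i * conjElt d l * (b ^ i)⁻¹ := by simp [conjElt, hj, mul_assoc]
  rcases pairAlternative hk hl hd with h | h | h | ⟨rfl, rfl, rfl⟩
  · refine Or.inl fun e he => ⟨_, h e he, ?_⟩
    rw [hj]
    simp [conjElt, mul_assoc]
  · refine Or.inr (Or.inl ?_)
    simp only [hx, hy]
    convert h.conj_b_pow i using 1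
    group
  · refine Or.inr (Or.inr (Or.inl ?_))
    simp only [hx, hy]
    convert h.conj_b_pow i using 1
    group
  · refine Or.inr (Or.inr (Or.inr ?_))
    simp only [hx, hy]
    have hi : i % 3 < 3 := Nat.mod_lt _ (by norm_num)
    rw [← b_pow_mod i]
    generalize i % 3 = m at hi
    interval_cases m
    · refine Or.inr (Or.inl ?_)
      simp [s1_eq_conjElt]
    · refine Or.inl ?_
      rw [← s1_eq_conjElt]
      simp [conjElt]
    · refine Or.inr (Or.inr ?_)
      simp [conjElt, s1, letter, pow_two, mul_assoc, w_mul_w_mul, w_inv, b_inv,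
        b_mul_b_mul_b_mul, b_mul_b_mul_b]

theorem prod_eq_or_exists_reducible (x : ℕ × List Bool) (D : List (ℕ × List Bool))
    (hD : ∀ z ∈ x :: D, Canonical z.2) :
    (∃ e, StartsW e ∧
      ((x :: D).map fun z => conjElt z.1 z.2).prod = b ^ x.1 * eval x.2 * e) ∨
    ∃ p y z t, x :: D = p ++ y :: z :: t ∧ Reducible y z := by
  induction D generalizing x with
  | nil =>
    refine Or.inl ⟨_, startsW_conjElt (hD x (by simp)) x.1, ?_⟩
    simp [conjElt, mul_assoc]
  | cons y D ih =>
    rcases ih y (fun z hz => hD z (List.mem_cons_of_mem _ hz)) with ⟨e, he, h⟩ | h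
    · rcases startsW_or_reducible (i := x.1) (j := y.1) (hD x (by simp)) (hD y (by simp))
        with h' | h'
      · obtain ⟨e', he', h''⟩ := h' e he
        exact Or.inl ⟨e', he', by rw [List.map_cons, List.prod_cons, h, h'']⟩
      · exact Or.inr ⟨[], x, y, D, rfl, h'⟩
    · obtain ⟨p, u, v, t, h, hr⟩ := h
      exact Or.inr ⟨x :: p, u, v, t, by rw [h]; rfl, hr⟩

/-! ### Uniqueness of normal forms -/

/-- Normal forms `bⁱ k wʲ`. -/
abbrev NormalForm := Fin 3 × List Bool × Bool

/-- Left multiplication by `w` on normal forms. -/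
def wFun : NormalForm → NormalForm
  | (0, [], j) => (0, [], !j)
  | (0, false :: k, j) => (1, k, j)
  | (0, true :: k, j) => (2, k, j)
  | (1, k, j) => (0, false :: k, j)
  | (2, k, j) => (0, true :: k, j)

/-- Left multiplication by `b` on normal forms. -/
def bFun (x : NormalForm) : NormalForm := (x.1 + 1, x.2)

theorem wFun_wFun (x : NormalForm) : wFun (wFun x) = x := by
  obtain ⟨i, k, j⟩ := x
  fin_cases i
  · rcases k with _ | ⟨_ | _, k⟩ <;> simp [wFun]
  · simp [wFun]
  · simp [wFun]

theorem bFun_bFun_bFun (x : NormalForm) : bFun (bFun (bFun x)) = x := by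
  obtain ⟨i, k, j⟩ := x
  fin_cases i <;> simp [bFun]

/-- The permutation of normal forms induced by `w`. -/
def wPerm : Equiv.Perm NormalForm := ⟨wFun, wFun, wFun_wFun, wFun_wFun⟩

/-- The permutation of normal forms induced by `b`. -/
def bPerm : Equiv.Perm NormalForm :=
  ⟨bFun, fun x => bFun (bFun x), bFun_bFun_bFun, bFun_bFun_bFun⟩

/-- The homomorphism from `ℤ/n` sending a generator to an element with `n`-th power `1`. -/
def powHom {H : Type*} [Group H] (n : ℕ) [NeZero n] (x : H) (hx : x ^ n = 1) :
    Multiplicative (ZMod n) →* H where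
  toFun z := x ^ z.toAdd.val
  map_one' := by simp
  map_mul' y z := by
    rw [toAdd_mul, ZMod.val_add, ← pow_eq_pow_mod _ hx, pow_add]

/-- The action of `G` on normal forms. -/
def normalFormHom : G23 →* Equiv.Perm NormalForm :=
  Monoid.Coprod.lift
    (powHom 2 wPerm (Equiv.ext fun x => by simp [pow_two, wPerm, wFun_wFun]))
    (powHom 3 bPerm (Equiv.ext fun x => by simp [pow_succ, bPerm, bFun_bFun_bFun]))

theorem normalFormHom_w (x : NormalForm) : normalFormHom w x = wFun x := by
  simp [normalFormHom, w, powHom, wPerm, ZMod.val_one]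

theorem normalFormHom_b (x : NormalForm) : normalFormHom b x = bFun x := by
  simp [normalFormHom, b, powHom, bPerm, ZMod.val_one]

theorem normalFormHom_b_pow (i : ℕ) (k : List Bool) (j : Bool) :
    normalFormHom (b ^ i) (0, k, j) = (Fin.ofNat 3 i, k, j) := by
  induction i with
  | zero => simp
  | succ i ih =>
    rw [pow_succ', map_mul, Equiv.Perm.mul_apply, ih, normalFormHom_b]
    simp [bFun, Fin.ext_iff, Fin.val_add]

theorem normalFormHom_letter (c : Bool) (k : List Bool) (j : Bool) :
    normalFormHom (letter c) (0, k, j) = (0, c :: k, j) := by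
  cases c <;> simp [letter, normalFormHom_w, normalFormHom_b, bFun, wFun]

theorem normalFormHom_eval (k l : List Bool) (j : Bool) :
    normalFormHom (eval k) (0, l, j) = (0, k ++ l, j) := by
  induction k with
  | nil => simp
  | cons c k ih => simp [ih, normalFormHom_letter]

theorem StartsW.normalFormHom_apply {e : G23} (h : StartsW e) :
    ∃ k j, normalFormHom e (0, [], false) = (0, k, j) ∧ (k ≠ [] ∨ j = true) := by
  induction h with
  | w => exact ⟨[], true, by simp [normalFormHom_w, wFun], by simp⟩
  | letter c => exact ⟨[c], false, normalFormHom_letter c [] false, by simp⟩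
  | letter_mul c _ ih =>
    obtain ⟨k, j, h, -⟩ := ih
    exact ⟨c :: k, j, by simp [h, normalFormHom_letter], by simp⟩

theorem s1_pow_succ (n : ℕ) :
    s1 ^ (n + 1) = b * eval (List.replicate n true ++ [false]) := by
  induction n with
  | zero => simp [s1, letter, mul_assoc]
  | succ n ih =>
    rw [pow_succ', ih]
    simp [s1, List.replicate_succ, letter, mul_assoc]

theorem normalFormHom_s1_pow_succ (n : ℕ) :
    normalFormHom (s1 ^ (n + 1)) (0, [], false) = (1, List.replicate n true ++ [false], false) := by
  rw [s1_pow_succ, map_mul, Equiv.Perm.mul_apply, normalFormHom_eval, normalFormHom_b]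
  simp [bFun]

theorem s1_pow_succ_ne_one (n : ℕ) : s1 ^ (n + 1) ≠ 1 := by
  intro h
  have := normalFormHom_s1_pow_succ n
  rw [h] at this
  simp at this

theorem conjElt_eq_s1_of_eq {i n : ℕ} {k : List Bool} (hk : Canonical k) {e : G23}
    (he : StartsW e) (h : b ^ i * eval k * e = s1 ^ (n + 1)) : conjElt i k = s1 := by
  obtain ⟨m, j, hm, hmj⟩ := he.normalFormHom_apply
  have key := normalFormHom_s1_pow_succ n
  rw [← h, map_mul, map_mul, Equiv.Perm.mul_apply, Equiv.Perm.mul_apply, hm, normalFormHom_eval,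
    normalFormHom_b_pow] at key
  simp only [Prod.mk.injEq] at key
  obtain ⟨hi, hkm, rfl⟩ := key
  have hm0 : m ≠ [] := by simpa using hmj
  obtain ⟨m', a, rfl⟩ := List.eq_nil_or_concat' m |>.resolve_left hm0
  rw [← List.append_assoc] at hkm
  have hrep := (List.append_inj' hkm rfl).1
  have hk0 : k = [] := by
    by_contra hne
    refine hk ?_
    rw [List.getLast?_eq_getLast_of_ne_nil hne]
    have : k.getLast hne ∈ List.replicate n true := by
      rw [← hrep]
      exact List.mem_append_left _ (List.getLast_mem hne)
    rw [List.eq_of_mem_replicate this]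
  subst hk0
  have hi3 : i % 3 = 1 := by simpa using congrArg Fin.val hi
  rw [← s1_eq_conjElt]
  simp only [conjElt]
  rw [← b_pow_mod i, hi3]

/-! ### The reduction process -/

theorem exists_hurwitzEquiv_mem_s1 (n N : ℕ) (D : List (ℕ × List Bool))
    (hN : (D.map fun z => z.2.length).sum = N) (hD : ∀ z ∈ D, Canonical z.2)
    (hprod : (D.map fun z => conjElt z.1 z.2).prod = s1 ^ (n + 1)) :
    ∃ L, HurwitzEquiv (D.map fun z => conjElt z.1 z.2) L ∧ s1 ∈ L := by
  induction N using Nat.strong_induction_on generalizing D with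
  | _ N ih =>
  cases D with
  | nil => exact absurd (by simpa using hprod.symm) (s1_pow_succ_ne_one n)
  | cons x D =>
    rcases prod_eq_or_exists_reducible x D hD with ⟨e, he, h⟩ | ⟨p, y, z, t, h, hr⟩
    · refine ⟨_, Relation.ReflTransGen.refl, ?_⟩
      rw [List.map_cons, conjElt_eq_s1_of_eq (hD x (by simp)) he (h.symm.trans hprod)]
      exact List.mem_cons_self
    · rw [h] at hprod hN hD ⊢
      set f : ℕ × List Bool → G23 := fun z => conjElt z.1 z.2 with hf
      have hl : HurwitzMove ((p ++ y :: z :: t).map f)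
          (p.map f ++ f z :: ((f z)⁻¹ * f y * f z) :: t.map f) :=
        ⟨p.map f, f y, f z, t.map f, by simp, Or.inl rfl⟩
      have hr' : HurwitzMove ((p ++ y :: z :: t).map f)
          (p.map f ++ (f y * f z * (f y)⁻¹) :: f y :: t.map f) :=
        ⟨p.map f, f y, f z, t.map f, by simp, Or.inr rfl⟩
      rcases hr with ⟨i, k, hk, hlen, hik⟩ | ⟨i, k, hk, hlen, hik⟩ | hs | hs | hs
      · have hmap : (p ++ (i, k) :: y :: t).map f =
            p.map f ++ (f y * f z * (f y)⁻¹) :: f y :: t.map f := by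
          simp [hf, hik]
        rw [← hmap] at hr'
        obtain ⟨L, hL, hs⟩ := ih _ (by simp at hN ⊢; omega) (p ++ (i, k) :: y :: t) rfl
          (by
            intro u hu
            simp only [List.mem_append, List.mem_cons] at hu hD
            rcases hu with hu | rfl | rfl | hu <;> first | exact hk | exact hD _ (by tauto))
          (hr'.prod_eq.trans hprod)
        exact ⟨L, hL.head hr', hs⟩
      · have hmap : (p ++ z :: (i, k) :: t).map f =
            p.map f ++ f z :: ((f z)⁻¹ * f y * f z) :: t.map f := by
          simp [hf, hik]
        rw [← hmap] at hl
        obtain ⟨L, hL, hs⟩ := ih _ (by simp at hN ⊢; omega) (p ++ z :: (i, k) :: t) rfl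
          (by
            intro u hu
            simp only [List.mem_append, List.mem_cons] at hu hD
            rcases hu with hu | rfl | rfl | hu <;> first | exact hk | exact hD _ (by tauto))
          (hl.prod_eq.trans hprod)
        exact ⟨L, hL.head hl, hs⟩
      · exact ⟨_, Relation.ReflTransGen.refl, List.mem_map.2 ⟨y, by simp, hs⟩⟩
      · exact ⟨_, Relation.ReflTransGen.refl, List.mem_map.2 ⟨z, by simp, hs⟩⟩
      · exact ⟨_, Relation.ReflTransGen.single hl, by simp [hf, hs]⟩

theorem exists_map_conjElt (L : List G23) (hL : ∀ g ∈ L, IsConj s1 g) :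
    ∃ D : List (ℕ × List Bool), (∀ z ∈ D, Canonical z.2) ∧
      D.map (fun z => conjElt z.1 z.2) = L := by
  induction L with
  | nil => exact ⟨[], by simp, rfl⟩
  | cons g L ih =>
    obtain ⟨D, hD, h⟩ := ih fun x hx => hL x (List.mem_cons_of_mem _ hx)
    obtain ⟨i, k, hk, hg⟩ := exists_canonical_of_isConj (hL g List.mem_cons_self)
    exact ⟨(i, k) :: D, by simpa using ⟨hk, by simpa using hD⟩, by simp [h, hg]⟩

end G23

/-- **`PSL(2,ℤ)` normal factorization, Kodaira type `wIₙ`.**  If `s₁ⁿ = g₁⋯g_r` with each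
`gᵢ` a conjugate of `s₁ = bwb`, then `r ≥ n` and a finite sequence of Hurwitz moves
transforms `(g₁,…,g_r)` into a sequence of conjugates of `s₁` whose first `n` terms all
equal `s₁` and whose remaining terms have product `1`. -/
theorem psl_normal_factorization_wIn (n : ℕ) (L : List G23)
    (hconj : ∀ g ∈ L, IsConj s1 g)
    (hprod : L.prod = s1 ^ n) :
    n ≤ L.length ∧
    ∃ L' : List G23, HurwitzEquiv L L' ∧ (∀ g ∈ L', IsConj s1 g) ∧
      L'.take n = List.replicate n s1 ∧ (L'.drop n).prod = 1 := by
  induction n generalizing L with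
  | zero =>
    exact ⟨Nat.zero_le _, L, Relation.ReflTransGen.refl, hconj, by simp, by simpa using hprod⟩
  | succ n ih =>
    obtain ⟨D, hD, rfl⟩ := G23.exists_map_conjElt L hconj
    obtain ⟨L₁, hL₁, hs⟩ := G23.exists_hurwitzEquiv_mem_s1 n _ D rfl hD hprod
    obtain ⟨T, hT⟩ := HurwitzEquiv.exists_cons_of_mem hs
    have hLT := hL₁.trans hT
    have hTconj := HurwitzEquiv.forall_isConj hLT hconj
    have hTprod : T.prod = s1 ^ n := by
      have := (HurwitzEquiv.prod_eq hLT).trans hprod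
      rw [List.prod_cons, pow_succ'] at this
      exact mul_left_cancel this
    obtain ⟨hlen, T', hTT', hc, htake, hdrop⟩ :=
      ih T (fun g hg => hTconj g (List.mem_cons_of_mem _ hg)) hTprod
    refine ⟨?_, s1 :: T', hLT.trans (hTT'.cons s1), ?_, ?_, ?_⟩
    · rw [← HurwitzEquiv.length_eq hLT]
      simpa using hlen
    · exact List.forall_mem_cons.2 ⟨IsConj.refl _, hc⟩
    · simp [htake, List.replicate_succ]
    · simpa using hdrop
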